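/- Case 4 of Theorem 1.2: the hypergeometric group Γ(f,g) generated by the companion matrices A and B of f(x) = x^5 - 3x^4 + 4x^3 - 4x^2 + 3x - 1 and g(x) = x^5 - x^4 + x^3 + x^2 - x + 1 is an arithmetic subgroup of the integral orthogonal group O_Q(ℤ): Γ(f,g) is contained in O_Q(ℤ) (in particular Aᵀ·Q·A = Q and Bᵀ·Q·B = Q), and Γ(f,g) has finite index in O_Q(ℤ). -/

import Mathlib

open Matrix

/-- The companion matrix `A` of `f(x) = x^5 - 3*x^4 + 4*x^3 - 4*x^2 + 3*x - 1`. -/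
def matA : Matrix (Fin 5) (Fin 5) ℤ :=
  !![(0 : ℤ), 0, 0, 0, 1; 1, 0, 0, 0, -3; 0, 1, 0, 0, 4; 0, 0, 1, 0, -4; 0, 0, 0, 1, 3]

/-- The companion matrix `B` of `g(x) = x^5 - x^4 + x^3 + x^2 - x + 1`. -/
def matB : Matrix (Fin 5) (Fin 5) ℤ :=
  !![(0 : ℤ), 0, 0, 0, -1; 1, 0, 0, 0, 1; 0, 1, 0, 0, -1; 0, 0, 1, 0, -1; 0, 0, 0, 1, 1]

/-- The symmetric integer matrix `Q` of the quadratic form preserved by `Γ(f,g)`. -/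
def matQ : Matrix (Fin 5) (Fin 5) ℤ :=
  !![(7 : ℤ), 9, 7, -7, -25; 9, 7, 9, 7, -7; 7, 9, 7, 9, 7; -7, 7, 9, 7, 9; -25, -7, 7, 9, 7]

/-- The integral orthogonal group `O_Q(ℤ)` of a matrix `Q`, as the subgroup of `GL₅(ℤ)`
consisting of all `M` with `Mᵀ * Q * M = Q`. -/
def orthogonalSubgroup (Q : Matrix (Fin 5) (Fin 5) ℤ) : Subgroup (GL (Fin 5) ℤ) where
  carrier := { M : GL (Fin 5) ℤ |
      (M : Matrix (Fin 5) (Fin 5) ℤ)ᵀ * Q * (M : Matrix (Fin 5) (Fin 5) ℤ) = Q }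
  one_mem' := by simp
  mul_mem' := by
    intro a b ha hb
    simp only [Set.mem_setOf_eq, Units.val_mul, transpose_mul] at ha hb ⊢
    calc ((b : Matrix (Fin 5) (Fin 5) ℤ)ᵀ * (a : Matrix (Fin 5) (Fin 5) ℤ)ᵀ) * Q *
          ((a : Matrix (Fin 5) (Fin 5) ℤ) * (b : Matrix (Fin 5) (Fin 5) ℤ))
        = (b : Matrix (Fin 5) (Fin 5) ℤ)ᵀ *
            ((a : Matrix (Fin 5) (Fin 5) ℤ)ᵀ * Q * (a : Matrix (Fin 5) (Fin 5) ℤ)) *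
            (b : Matrix (Fin 5) (Fin 5) ℤ) := by
          simp only [mul_assoc]
      _ = Q := by rw [ha, hb]
  inv_mem' := by
    intro a ha
    simp only [Set.mem_setOf_eq] at ha ⊢
    calc ((a⁻¹ : GL (Fin 5) ℤ) : Matrix (Fin 5) (Fin 5) ℤ)ᵀ * Q *
          ((a⁻¹ : GL (Fin 5) ℤ) : Matrix (Fin 5) (Fin 5) ℤ)
        = ((a⁻¹ : GL (Fin 5) ℤ) : Matrix (Fin 5) (Fin 5) ℤ)ᵀ *
            ((a : Matrix (Fin 5) (Fin 5) ℤ)ᵀ * Q * (a : Matrix (Fin 5) (Fin 5) ℤ)) *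
            ((a⁻¹ : GL (Fin 5) ℤ) : Matrix (Fin 5) (Fin 5) ℤ) := by rw [ha]
      _ = ((a : Matrix (Fin 5) (Fin 5) ℤ) *
            ((a⁻¹ : GL (Fin 5) ℤ) : Matrix (Fin 5) (Fin 5) ℤ))ᵀ * Q *
          ((a : Matrix (Fin 5) (Fin 5) ℤ) *
            ((a⁻¹ : GL (Fin 5) ℤ) : Matrix (Fin 5) (Fin 5) ℤ)) := by
          simp only [transpose_mul, mul_assoc]
      _ = Q := by rw [Units.mul_inv]; simp


namespace HG

/-- Five by five integer matrices. -/
abbrev M5 := Matrix (Fin 5) (Fin 5) ℤ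

/-- The form `2(ad - bc) - 16 w^2` in the coordinates `(a,b,c,d,w)`. -/
def qN : M5 :=
  !![(0 : ℤ), 0, 0, 1, 0; 0, 0, -1, 0, 0; 0, -1, 0, 0, 0; 1, 0, 0, 0, 0; 0, 0, 0, 0, -16]

/-- `A` in the new coordinates. -/
def mA : M5 :=
  !![(-1 : ℤ), 0, 1, 0, 0; 3, 0, -2, 0, 0; -3, 1, 3, -1, 0; 1, -3, 2, 2, -16; -1, 0, 1, 0, -1]

/-- `B` in the new coordinates. -/
def mB : M5 :=
  !![(-1 : ℤ), -1, 0, 0, 0; 3, 2, 0, 0, 0; -3, -3, -1, -1, 0; 1, -2, 3, 2, -16; -1, -1, 0, 0, -1]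

/-- The inverse of `mA`. -/
def mAi : M5 :=
  !![(2 : ℤ), 1, 0, 0, 0; -2, 3, -2, -1, 16; 3, 1, 0, 0, 0; 1, 3, -3, -1, 16; 1, 0, 0, 0, -1]

/-- The inverse of `mB`. -/
def mBi : M5 :=
  !![(2 : ℤ), 1, 0, 0, 0; -3, -1, 0, 0, 0; 2, -3, 2, 1, -16; 1, 3, -3, -1, 16; 1, 0, 0, 0, -1]

/-- Left lower transvection. -/
def UL (k : ℤ) : M5 :=
  !![(1 : ℤ), 0, 0, 0, 0; 0, 1, 0, 0, 0; k, 0, 1, 0, 0; 0, k, 0, 1, 0; 0, 0, 0, 0, 1]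

/-- Left upper transvection. -/
def VL (k : ℤ) : M5 :=
  !![(1 : ℤ), 0, k, 0, 0; 0, 1, 0, k, 0; 0, 0, 1, 0, 0; 0, 0, 0, 1, 0; 0, 0, 0, 0, 1]

/-- Right transvection `b += k a`, `d += k c`. -/
def UR (k : ℤ) : M5 :=
  !![(1 : ℤ), 0, 0, 0, 0; k, 1, 0, 0, 0; 0, 0, 1, 0, 0; 0, 0, k, 1, 0; 0, 0, 0, 0, 1]

/-- Right transvection `a += k b`, `c += k d`. -/
def VR (k : ℤ) : M5 :=
  !![(1 : ℤ), k, 0, 0, 0; 0, 1, 0, 0, 0; 0, 0, 1, k, 0; 0, 0, 0, 1, 0; 0, 0, 0, 0, 1]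

/-- Eichler transformation fixing `e_d`. -/
def TD (k : ℤ) : M5 :=
  !![(1 : ℤ), 0, 0, 0, 0; 0, 1, 0, 0, 0; 0, 0, 1, 0, 0; 8 * k ^ 2, 0, 0, 1, 16 * k; k, 0, 0, 0, 1]

/-- Eichler transformation fixing `e_a`. -/
def TA (k : ℤ) : M5 :=
  !![(1 : ℤ), 0, 0, 8 * k ^ 2, 16 * k; 0, 1, 0, 0, 0; 0, 0, 1, 0, 0; 0, 0, 0, 1, 0; 0, 0, 0, k, 1]

/-- Eichler transformation fixing `e_b`. -/
def TB (k : ℤ) : M5 :=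
  !![(1 : ℤ), 0, 0, 0, 0; 0, 1, -8 * k ^ 2, 0, 16 * k; 0, 0, 1, 0, 0; 0, 0, 0, 1, 0; 0, 0, -k, 0, 1]

/-- Eichler transformation fixing `e_c`. -/
def TC (k : ℤ) : M5 :=
  !![(1 : ℤ), 0, 0, 0, 0; 0, 1, 0, 0, 0; 0, -8 * k ^ 2, 1, 0, 16 * k; 0, 0, 0, 1, 0; 0, -k, 0, 0, 1]

/-- Reflection exchanging `b` and `-c`. -/
def mC : M5 :=
  !![(1 : ℤ), 0, 0, 0, 0; 0, 0, -1, 0, 0; 0, -1, 0, 0, 0; 0, 0, 0, 1, 0; 0, 0, 0, 0, 1]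

/-- Reflection `w ↦ -w`. -/
def mR : M5 :=
  !![(1 : ℤ), 0, 0, 0, 0; 0, 1, 0, 0, 0; 0, 0, 1, 0, 0; 0, 0, 0, 1, 0; 0, 0, 0, 0, -1]

/-- Left Weyl element. -/
def WL : M5 :=
  !![(0 : ℤ), 0, -1, 0, 0; 0, 0, 0, -1, 0; 1, 0, 0, 0, 0; 0, 1, 0, 0, 0; 0, 0, 0, 0, 1]

/-- Right Weyl element. -/
def WR : M5 :=
  !![(0 : ℤ), -1, 0, 0, 0; 1, 0, 0, 0, 0; 0, 0, 0, -1, 0; 0, 0, 1, 0, 0; 0, 0, 0, 0, 1]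

/-- The extra element of the Levi subgroup fixing `e_a` and `e_d`. -/
def mZ : M5 :=
  !![(1 : ℤ), 0, 0, 0, 0; 0, 8, -9, 0, -48; 0, -9, 8, 0, 48; 0, 0, 0, 1, 0; 0, 3, -3, 0, -17]

/-- Closure properties of the set of matrices we are allowed to multiply with. -/
structure Good (I : M5 → Prop) : Prop where
  one : I 1
  mul : ∀ X Y, I X → I Y → I (X * Y)
  neg : ∀ X, I X → I (-X)
  inv : ∀ X Y, X * Y = 1 → I X → I Y
  iso : ∀ X, I X → Xᵀ * qN * X = qN
  a : I mA
  b : I mB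

section gens
variable {I : M5 → Prop} (h : Good I)

lemma fam (h : Good I) (F : ℤ → M5) (h0 : F 0 = 1) (hadd : ∀ j k, F (j + k) = F j * F k) (h1 : I (F 1))
    (k : ℤ) : I (F k) := by
  have hm : I (F (-1)) := by
    refine h.inv (F 1) _ ?_ h1
    rw [← hadd]; simpa using h0
  induction k using Int.induction_on with
  | zero => rw [h0]; exact h.one
  | succ i ih => rw [hadd]; exact h.mul _ _ ih h1
  | pred i ih => rw [sub_eq_add_neg, hadd]; exact h.mul _ _ ih hm

lemma UL_add (j k : ℤ) : UL (j + k) = UL j * UL k := by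
  ext i l; fin_cases i <;> fin_cases l <;> simp [UL, Matrix.mul_apply, Fin.sum_univ_five]
lemma VL_add (j k : ℤ) : VL (j + k) = VL j * VL k := by
  ext i l; fin_cases i <;> fin_cases l <;> simp [VL, Matrix.mul_apply, Fin.sum_univ_five, add_comm]
lemma UR_add (j k : ℤ) : UR (j + k) = UR j * UR k := by
  ext i l; fin_cases i <;> fin_cases l <;> simp [UR, Matrix.mul_apply, Fin.sum_univ_five]
lemma VR_add (j k : ℤ) : VR (j + k) = VR j * VR k := by
  ext i l; fin_cases i <;> fin_cases l <;> simp [VR, Matrix.mul_apply, Fin.sum_univ_five, add_comm]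
lemma TD_add (j k : ℤ) : TD (j + k) = TD j * TD k := by
  ext i l; fin_cases i <;> fin_cases l <;> simp [TD, Matrix.mul_apply, Fin.sum_univ_five] <;> ring
lemma TA_add (j k : ℤ) : TA (j + k) = TA j * TA k := by
  ext i l; fin_cases i <;> fin_cases l <;> simp [TA, Matrix.mul_apply, Fin.sum_univ_five] <;> ring
lemma TB_add (j k : ℤ) : TB (j + k) = TB j * TB k := by
  ext i l; fin_cases i <;> fin_cases l <;> simp [TB, Matrix.mul_apply, Fin.sum_univ_five] <;> ring
lemma TC_add (j k : ℤ) : TC (j + k) = TC j * TC k := by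
  ext i l; fin_cases i <;> fin_cases l <;> simp [TC, Matrix.mul_apply, Fin.sum_univ_five] <;> ring

lemma gAi (h : Good I) : I mAi := h.inv mA _ (by decide +kernel) h.a
lemma gBi (h : Good I) : I mBi := h.inv mB _ (by decide +kernel) h.b

lemma gUL (h : Good I) (k : ℤ) : I (UL k) := by
  refine fam h UL (by decide +kernel) UL_add ?_ k
  have : UL 1 = -(mB * mB * mB) := by decide +kernel
  rw [this]
  exact h.neg _ (h.mul _ _ (h.mul _ _ h.b h.b) h.b)

lemma gC (h : Good I) : I mC := by
  have : mC = mAi * mB := by decide +kernel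
  rw [this]
  exact h.mul _ _ (gAi h) h.b

lemma gUR (h : Good I) (k : ℤ) : I (UR k) := by
  refine fam h UR (by decide +kernel) UR_add ?_ k
  have : UR 1 = mC * UL (-1) * mC := by decide +kernel
  rw [this]
  exact h.mul _ _ (h.mul _ _ (gC h) (gUL h _)) (gC h)

lemma gVL (h : Good I) (k : ℤ) : I (VL k) := by
  refine fam h VL (by decide +kernel) VL_add ?_ k
  have : VL 1 = mB * mA * mA * (UL (-1) * (mAi * mAi * mBi)) := by decide +kernel
  rw [this]
  exact h.mul _ _ (h.mul _ _ (h.mul _ _ h.b h.a) h.a)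
    (h.mul _ _ (gUL h _) (h.mul _ _ (h.mul _ _ (gAi h) (gAi h)) (gBi h)))

lemma gVR (h : Good I) (k : ℤ) : I (VR k) := by
  refine fam h VR (by decide +kernel) VR_add ?_ k
  have : VR 1 = mC * VL (-1) * mC := by decide +kernel
  rw [this]
  exact h.mul _ _ (h.mul _ _ (gC h) (gVL h _)) (gC h)

lemma gWL (h : Good I) : I WL := by
  have : WL = VL (-1) * UL 1 * VL (-1) := by decide +kernel
  rw [this]
  exact h.mul _ _ (h.mul _ _ (gVL h _) (gUL h _)) (gVL h _)

lemma gWR (h : Good I) : I WR := by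
  have : WR = VR (-1) * UR 1 * VR (-1) := by decide +kernel
  rw [this]
  exact h.mul _ _ (h.mul _ _ (gVR h _) (gUR h _)) (gVR h _)

lemma gR (h : Good I) : I mR := by
  have : mR = -(WL * WL) := by decide +kernel
  rw [this]
  exact h.neg _ (h.mul _ _ (gWL h) (gWL h))

lemma gTD (h : Good I) (k : ℤ) : I (TD k) := by
  refine fam h TD (by decide +kernel) TD_add ?_ k
  have : TD 1 = -(UL (-3) * UR 3 * (mB * VR (-1))) := by decide +kernel
  rw [this]
  exact h.neg _ (h.mul _ _ (h.mul _ _ (gUL h _) (gUR h _)) (h.mul _ _ h.b (gVR h _)))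

lemma gTA (h : Good I) (k : ℤ) : I (TA k) := by
  refine fam h TA (by decide +kernel) TA_add ?_ k
  have : TA 1 = WL * WR * (TD 1 * (WL * WR)) := by decide +kernel
  rw [this]
  have w := h.mul _ _ (gWL h) (gWR h)
  exact h.mul _ _ w (h.mul _ _ (gTD h _) w)

lemma gTB (h : Good I) (k : ℤ) : I (TB k) := by
  refine fam h TB (by decide +kernel) TB_add ?_ k
  have : TB 1 = WL * TD (-1) * (WL * WL * WL) := by decide +kernel
  rw [this]
  have w := gWL h
  exact h.mul _ _ (h.mul _ _ w (gTD h _)) (h.mul _ _ (h.mul _ _ w w) w)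

lemma gTC (h : Good I) (k : ℤ) : I (TC k) := by
  refine fam h TC (by decide +kernel) TC_add ?_ k
  have : TC 1 = WR * TD (-1) * (WR * WR * WR) := by decide +kernel
  rw [this]
  have w := gWR h
  exact h.mul _ _ (h.mul _ _ w (gTD h _)) (h.mul _ _ (h.mul _ _ w w) w)

lemma gZ (h : Good I) : I mZ := by
  let t : M5 := !![1, 3, -3, -1, -16; 0, 1, 0, -3, 0; 0, 0, 1, 3, 0; 0, 0, 0, 1, 0; 0, 0, 0, -1, 1]
  let s : M5 := !![1, 0, 0, 0, 0; -3, 1, 0, 0, 0; 3, 0, 1, 0, 0; -1, 3, -3, 1, -16; -1, 0, 0, 0, 1]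
  have ht : t = VR 3 * VL (-3) * TA (-1) := by decide +kernel
  have hs : s = UR (-3) * UL 3 * TD (-1) := by decide +kernel
  have it : I t := by
    rw [ht]; exact h.mul _ _ (h.mul _ _ (gVR h _) (gVL h _)) (gTA h _)
  have is : I s := by
    rw [hs]; exact h.mul _ _ (h.mul _ _ (gUR h _) (gUL h _)) (gTD h _)
  have : mZ = -((WL * mC * (WL * WL * WL)) * (t * s * t)) := by decide +kernel
  rw [this]
  have w := gWL h
  exact h.neg _ (h.mul _ _ (h.mul _ _ (h.mul _ _ w (gC h)) (h.mul _ _ (h.mul _ _ w w) w))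
    (h.mul _ _ (h.mul _ _ it is) it))

end gens

/-! The effect of the moves on the entries of a matrix. -/

@[simp] lemma row_UL (k : ℤ) (M : M5) (j : Fin 5) :
    (UL k * M) 0 j = M 0 j ∧
    (UL k * M) 1 j = M 1 j ∧
    (UL k * M) 2 j = M 2 j + k * M 0 j ∧
    (UL k * M) 3 j = M 3 j + k * M 1 j ∧
    (UL k * M) 4 j = M 4 j := by
  refine ⟨?_, ?_, ?_, ?_, ?_⟩ <;> simp [UL, Matrix.mul_apply, Fin.sum_univ_five] <;> ring

@[simp] lemma row_VL (k : ℤ) (M : M5) (j : Fin 5) :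
    (VL k * M) 0 j = M 0 j + k * M 2 j ∧
    (VL k * M) 1 j = M 1 j + k * M 3 j ∧
    (VL k * M) 2 j = M 2 j ∧
    (VL k * M) 3 j = M 3 j ∧
    (VL k * M) 4 j = M 4 j := by
  refine ⟨?_, ?_, ?_, ?_, ?_⟩ <;> simp [VL, Matrix.mul_apply, Fin.sum_univ_five] <;> ring

@[simp] lemma row_UR (k : ℤ) (M : M5) (j : Fin 5) :
    (UR k * M) 0 j = M 0 j ∧
    (UR k * M) 1 j = M 1 j + k * M 0 j ∧
    (UR k * M) 2 j = M 2 j ∧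
    (UR k * M) 3 j = M 3 j + k * M 2 j ∧
    (UR k * M) 4 j = M 4 j := by
  refine ⟨?_, ?_, ?_, ?_, ?_⟩ <;> simp [UR, Matrix.mul_apply, Fin.sum_univ_five] <;> ring

@[simp] lemma row_VR (k : ℤ) (M : M5) (j : Fin 5) :
    (VR k * M) 0 j = M 0 j + k * M 1 j ∧
    (VR k * M) 1 j = M 1 j ∧
    (VR k * M) 2 j = M 2 j + k * M 3 j ∧
    (VR k * M) 3 j = M 3 j ∧
    (VR k * M) 4 j = M 4 j := by
  refine ⟨?_, ?_, ?_, ?_, ?_⟩ <;> simp [VR, Matrix.mul_apply, Fin.sum_univ_five] <;> ring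

@[simp] lemma row_TD (k : ℤ) (M : M5) (j : Fin 5) :
    (TD k * M) 0 j = M 0 j ∧
    (TD k * M) 1 j = M 1 j ∧
    (TD k * M) 2 j = M 2 j ∧
    (TD k * M) 3 j = M 3 j + 8 * k ^ 2 * M 0 j + 16 * k * M 4 j ∧
    (TD k * M) 4 j = M 4 j + k * M 0 j := by
  refine ⟨?_, ?_, ?_, ?_, ?_⟩ <;> simp [TD, Matrix.mul_apply, Fin.sum_univ_five] <;> ring

@[simp] lemma row_TA (k : ℤ) (M : M5) (j : Fin 5) :
    (TA k * M) 0 j = M 0 j + 8 * k ^ 2 * M 3 j + 16 * k * M 4 j ∧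
    (TA k * M) 1 j = M 1 j ∧
    (TA k * M) 2 j = M 2 j ∧
    (TA k * M) 3 j = M 3 j ∧
    (TA k * M) 4 j = M 4 j + k * M 3 j := by
  refine ⟨?_, ?_, ?_, ?_, ?_⟩ <;> simp [TA, Matrix.mul_apply, Fin.sum_univ_five] <;> ring

@[simp] lemma row_TB (k : ℤ) (M : M5) (j : Fin 5) :
    (TB k * M) 0 j = M 0 j ∧
    (TB k * M) 1 j = M 1 j - 8 * k ^ 2 * M 2 j + 16 * k * M 4 j ∧
    (TB k * M) 2 j = M 2 j ∧
    (TB k * M) 3 j = M 3 j ∧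
    (TB k * M) 4 j = M 4 j - k * M 2 j := by
  refine ⟨?_, ?_, ?_, ?_, ?_⟩ <;> simp [TB, Matrix.mul_apply, Fin.sum_univ_five] <;> ring

@[simp] lemma row_TC (k : ℤ) (M : M5) (j : Fin 5) :
    (TC k * M) 0 j = M 0 j ∧
    (TC k * M) 1 j = M 1 j ∧
    (TC k * M) 2 j = M 2 j - 8 * k ^ 2 * M 1 j + 16 * k * M 4 j ∧
    (TC k * M) 3 j = M 3 j ∧
    (TC k * M) 4 j = M 4 j - k * M 1 j := by
  refine ⟨?_, ?_, ?_, ?_, ?_⟩ <;> simp [TC, Matrix.mul_apply, Fin.sum_univ_five] <;> ring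

@[simp] lemma row_mC (M : M5) (j : Fin 5) :
    (mC * M) 0 j = M 0 j ∧
    (mC * M) 1 j = -M 2 j ∧
    (mC * M) 2 j = -M 1 j ∧
    (mC * M) 3 j = M 3 j ∧
    (mC * M) 4 j = M 4 j := by
  refine ⟨?_, ?_, ?_, ?_, ?_⟩ <;> simp [mC, Matrix.mul_apply, Fin.sum_univ_five] <;> ring

@[simp] lemma row_mR (M : M5) (j : Fin 5) :
    (mR * M) 0 j = M 0 j ∧
    (mR * M) 1 j = M 1 j ∧
    (mR * M) 2 j = M 2 j ∧
    (mR * M) 3 j = M 3 j ∧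
    (mR * M) 4 j = -M 4 j := by
  refine ⟨?_, ?_, ?_, ?_, ?_⟩ <;> simp [mR, Matrix.mul_apply, Fin.sum_univ_five] <;> ring

@[simp] lemma row_WL (M : M5) (j : Fin 5) :
    (WL * M) 0 j = -M 2 j ∧
    (WL * M) 1 j = -M 3 j ∧
    (WL * M) 2 j = M 0 j ∧
    (WL * M) 3 j = M 1 j ∧
    (WL * M) 4 j = M 4 j := by
  refine ⟨?_, ?_, ?_, ?_, ?_⟩ <;> simp [WL, Matrix.mul_apply, Fin.sum_univ_five] <;> ring

@[simp] lemma row_WR (M : M5) (j : Fin 5) :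
    (WR * M) 0 j = -M 1 j ∧
    (WR * M) 1 j = M 0 j ∧
    (WR * M) 2 j = -M 3 j ∧
    (WR * M) 3 j = M 2 j ∧
    (WR * M) 4 j = M 4 j := by
  refine ⟨?_, ?_, ?_, ?_, ?_⟩ <;> simp [WR, Matrix.mul_apply, Fin.sum_univ_five] <;> ring

@[simp] lemma row_mZ (M : M5) (j : Fin 5) :
    (mZ * M) 0 j = M 0 j ∧
    (mZ * M) 1 j = 8 * M 1 j - 9 * M 2 j - 48 * M 4 j ∧
    (mZ * M) 2 j = -9 * M 1 j + 8 * M 2 j + 48 * M 4 j ∧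
    (mZ * M) 3 j = M 3 j ∧
    (mZ * M) 4 j = 3 * M 1 j - 3 * M 2 j - 17 * M 4 j := by
  refine ⟨?_, ?_, ?_, ?_, ?_⟩ <;> simp [mZ, Matrix.mul_apply, Fin.sum_univ_five] <;> ring


section reduction
variable {I : M5 → Prop}

/-- The matrix preserves the form. -/
def Iso (M : M5) : Prop := Mᵀ * qN * M = qN

lemma Iso.mul {X M : M5} (hX : Iso X) (hM : Iso M) : Iso (X * M) := by
  unfold Iso at *
  calc (X * M)ᵀ * qN * (X * M) = Mᵀ * (Xᵀ * qN * X) * M := by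
        simp only [Matrix.transpose_mul, Matrix.mul_assoc]
    _ = qN := by rw [hX, hM]

lemma Iso.entry {M : M5} (hM : Iso M) (i j : Fin 5) :
    M 0 i * M 3 j + M 3 i * M 0 j - M 1 i * M 2 j - M 2 i * M 1 j - 16 * (M 4 i * M 4 j)
      = qN i j := by
  have := congrFun (congrFun hM i) j
  rw [← this]
  simp [qN, Matrix.mul_apply, Fin.sum_univ_five]
  ring

/-- `M` can be moved to a matrix with property `P`. -/
def Reach (I : M5 → Prop) (P : M5 → Prop) (M : M5) : Prop := ∃ X, I X ∧ P (X * M)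

lemma Reach.step (h : Good I) {P : M5 → Prop} {M X : M5} (hX : I X) (hr : Reach I P (X * M)) :
    Reach I P M := by
  obtain ⟨Y, hY, hP⟩ := hr
  exact ⟨Y * X, h.mul _ _ hY hX, by rwa [Matrix.mul_assoc]⟩

lemma Reach.trans (h : Good I) {P P' : M5 → Prop} {M : M5} (hM : Iso M) (hr : Reach I P M)
    (hP : ∀ N, Iso N → P N → Reach I P' N) : Reach I P' M := by
  obtain ⟨Y, hY, hPY⟩ := hr
  exact Reach.step h hY (hP _ (Iso.mul (h.iso Y hY) hM) hPY)

/-- First column is `e_a`. -/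
def P1 (M : M5) : Prop := M 0 0 = 1 ∧ M 1 0 = 0 ∧ M 2 0 = 0 ∧ M 3 0 = 0 ∧ M 4 0 = 0

/-- The columns `0` and `3` are `e_a` and `e_d`. -/
def P2 (M : M5) : Prop := P1 M ∧ M 0 3 = 0 ∧ M 1 3 = 0 ∧ M 2 3 = 0 ∧ M 3 3 = 1 ∧ M 4 3 = 0

lemma emod_lt {a b : ℤ} (ha : a ≠ 0) (hab : ¬ a ∣ b) :
    b + -(b / a) * a ≠ 0 ∧ (b + -(b / a) * a).natAbs < a.natAbs := by
  have h1 : b + -(b / a) * a = b % a := by rw [Int.emod_def]; ring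
  rw [h1]
  refine ⟨fun h0 => hab (Int.dvd_of_emod_eq_zero h0), ?_⟩
  have h2 := Int.emod_nonneg b ha
  have h3 := Int.emod_lt_abs b ha
  rw [Int.abs_eq_natAbs] at h3
  omega

lemma step1_aux (h : Good I) (n : ℕ) : ∀ M, Iso M → M 0 0 ≠ 0 → (M 0 0).natAbs = n →
    Reach I P1 M := by
  induction n using Nat.strong_induction_on with
  | _ n ih =>
  -- the case `a ∤ b`
  have keyb : ∀ M, Iso M → M 0 0 ≠ 0 → (M 0 0).natAbs = n → ¬ M 0 0 ∣ M 1 0 → Reach I P1 M := by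
    intro M hM h0 hn hd
    have hX := h.mul _ _ (gWR h) (gUR h (-(M 1 0 / M 0 0)))
    have e : (WR * UR (-(M 1 0 / M 0 0)) * M) 0 0
        = -(M 1 0 + -(M 1 0 / M 0 0) * M 0 0) := by
      rw [Matrix.mul_assoc]
      simp []
    obtain ⟨l1, l2⟩ := emod_lt h0 hd
    refine Reach.step h hX (ih _ ?_ _ (Iso.mul (h.iso _ hX) hM) ?_ rfl)
    · rw [e, Int.natAbs_neg, ← hn]; exact l2
    · rw [e]; exact neg_ne_zero.2 l1
  have keyc : ∀ M, Iso M → M 0 0 ≠ 0 → (M 0 0).natAbs = n → ¬ M 0 0 ∣ M 2 0 → Reach I P1 M := by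
    intro M hM h0 hn hd
    have hX := h.mul _ _ (gWL h) (gUL h (-(M 2 0 / M 0 0)))
    have e : (WL * UL (-(M 2 0 / M 0 0)) * M) 0 0
        = -(M 2 0 + -(M 2 0 / M 0 0) * M 0 0) := by
      rw [Matrix.mul_assoc]
      simp []
    obtain ⟨l1, l2⟩ := emod_lt h0 hd
    refine Reach.step h hX (ih _ ?_ _ (Iso.mul (h.iso _ hX) hM) ?_ rfl)
    · rw [e, Int.natAbs_neg, ← hn]; exact l2
    · rw [e]; exact neg_ne_zero.2 l1
  -- the case `b = c = 0`
  have keyd : ∀ M, Iso M → M 0 0 ≠ 0 → (M 0 0).natAbs = n → M 1 0 = 0 → M 2 0 = 0 →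
      Reach I P1 M := by
    intro M hM h0 hn hb hc
    by_cases hd : M 0 0 ∣ M 3 0
    · have e00 := hM.entry 0 0
      have e03 := hM.entry 0 3
      simp [qN, hb, hc] at e00 e03
      -- `a` is a unit
      have hu : IsUnit (M 0 0) := by
        obtain ⟨x, hx⟩ := hd
        have c1 : IsCoprime (M 0 0) (16 * M 4 0 ^ 2) := by
          have c2 : IsCoprime (M 0 0) (16 * M 4 0) := by
            refine ⟨M 3 3 + x * M 0 3 , -M 4 3, ?_⟩
            rw [hx] at e03
            linarith [hb, hc]
          have c3 : IsCoprime (M 0 0) (M 4 0) := c2.of_mul_right_right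
          have := c2.mul_right c3
          rwa [mul_assoc, ← pow_two] at this
        refine c1.isUnit_of_dvd' dvd_rfl ?_
        exact ⟨2 * M 3 0, by linarith⟩
      -- kill `w`
      have fin : ∀ M, Iso M → M 0 0 = 1 → M 1 0 = 0 → M 2 0 = 0 → Reach I P1 M := by
        intro M hM h0 hb hc
        have e00 := hM.entry 0 0
        simp [qN, hb, hc, h0] at e00
        refine ⟨TD (-M 4 0), gTD h _, ?_⟩
        refine ⟨?_, ?_, ?_, ?_, ?_⟩ <;>
          simp [h0, hb, hc]
        linarith
      rcases Int.isUnit_iff.1 hu with h1 | h1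
      · exact fin M hM h1 hb hc
      · have hX := h.neg _ h.one
        refine Reach.step h hX (fin _ (Iso.mul (h.iso _ hX) hM) ?_ ?_ ?_) <;> simp [h1, hb, hc]
    · have hX := gVL h 1
      have e1 : (VL 1 * M) 0 0 = M 0 0 := by
        simp [hc]
      have e2 : (VL 1 * M) 1 0 = M 3 0 := by
        simp [hb]
      refine Reach.step h hX (keyb _ (Iso.mul (h.iso _ hX) hM) ?_ ?_ ?_)
      · rwa [e1]
      · rwa [e1]
      · rwa [e1, e2]
  intro M hM h0 hn
  by_cases hb : M 0 0 ∣ M 1 0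
  swap
  · exact keyb M hM h0 hn hb
  by_cases hc : M 0 0 ∣ M 2 0
  swap
  · exact keyc M hM h0 hn hc
  obtain ⟨x, hx⟩ := hb
  obtain ⟨y, hy⟩ := hc
  have hX := h.mul _ _ (gUL h (-y)) (gUR h (-x))
  have e0 : (UL (-y) * UR (-x) * M) 0 0 = M 0 0 := by
    rw [Matrix.mul_assoc]; simp []
  refine Reach.step h hX (keyd _ (Iso.mul (h.iso _ hX) hM) ?_ ?_ ?_ ?_)
  · rwa [e0]
  · rwa [e0]
  · rw [Matrix.mul_assoc]; simp [hx]; ring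
  · rw [Matrix.mul_assoc]; simp [hy]; ring

lemma step1 (h : Good I) (M : M5) (hM : Iso M) : Reach I P1 M := by
  have key : ∀ X, I X → (X * M) 0 0 ≠ 0 → Reach I P1 M := fun X hX h0 =>
    Reach.step h hX (step1_aux h _ _ (Iso.mul (h.iso _ hX) hM) h0 rfl)
  by_contra hcon
  have k0 : M 0 0 = 0 := by
    by_contra h0; exact hcon (key 1 h.one (by simpa using h0))
  have k1 : M 1 0 = 0 := by
    by_contra h0
    refine hcon (key _ (gWR h) ?_)
    simpa [] using h0
  have k2 : M 2 0 = 0 := by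
    by_contra h0
    refine hcon (key _ (gWL h) ?_)
    simpa [] using h0
  have k3 : M 3 0 = 0 := by
    by_contra h0
    refine hcon (key _ (h.mul _ _ (gWL h) (gWR h)) ?_)
    rw [Matrix.mul_assoc]
    simpa [] using h0
  have e := hM.entry 0 0
  have e3 := hM.entry 0 3
  simp [qN, k0, k1, k2, k3] at e e3
  simp [e] at e3

lemma step2 (h : Good I) (M : M5) (hM : Iso M) (hP : P1 M) : Reach I P2 M := by
  obtain ⟨a0, a1, a2, a3, a4⟩ := hP
  have e := hM.entry 0 3
  have e33 := hM.entry 3 3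
  simp [qN, a0, a1, a2, a3, a4] at e e33
  refine ⟨VR (-M 2 3) * (VL (-M 1 3) * TA (-M 4 3)),
    h.mul _ _ (gVR h _) (h.mul _ _ (gVL h _) (gTA h _)), ?_⟩
  rw [Matrix.mul_assoc, Matrix.mul_assoc]
  refine ⟨⟨?_, ?_, ?_, ?_, ?_⟩, ?_, ?_, ?_, ?_, ?_⟩ <;>
    simp [a0, a1, a2, a3, a4, e]
  rw [e] at e33
  linarith

/-- In addition the second column has no `w` coordinate. -/
def P3 (M : M5) : Prop := P2 M ∧ M 4 1 = 0

/-- All entries are small. -/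
def P4 (M : M5) : Prop := ∀ i j, M i j ∈ Finset.Icc (-1 : ℤ) 1

lemma P2.ext {M : M5} (hM : Iso M) (hP : P2 M) (j : Fin 5) (h0 : j ≠ 0) (h3 : j ≠ 3) :
    M 0 j = 0 ∧ M 3 j = 0 := by
  obtain ⟨⟨a0, a1, a2, a3, a4⟩, d0, d1, d2, d3, d4⟩ := hP
  have e := hM.entry 0 j
  have e' := hM.entry 3 j
  fin_cases j <;> simp_all [qN]

lemma P2.tb {M : M5} (hP : P2 M) (k : ℤ) : P2 (TB k * M) := by
  obtain ⟨⟨a0, a1, a2, a3, a4⟩, d0, d1, d2, d3, d4⟩ := hP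
  refine ⟨⟨?_, ?_, ?_, ?_, ?_⟩, ?_, ?_, ?_, ?_, ?_⟩ <;> simp [*]

lemma P2.tc {M : M5} (hP : P2 M) (k : ℤ) : P2 (TC k * M) := by
  obtain ⟨⟨a0, a1, a2, a3, a4⟩, d0, d1, d2, d3, d4⟩ := hP
  refine ⟨⟨?_, ?_, ?_, ?_, ?_⟩, ?_, ?_, ?_, ?_, ?_⟩ <;> simp [*]

lemma P2.c {M : M5} (hP : P2 M) : P2 (mC * M) := by
  obtain ⟨⟨a0, a1, a2, a3, a4⟩, d0, d1, d2, d3, d4⟩ := hP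
  refine ⟨⟨?_, ?_, ?_, ?_, ?_⟩, ?_, ?_, ?_, ?_, ?_⟩ <;> simp [*]

lemma P2.r {M : M5} (hP : P2 M) : P2 (mR * M) := by
  obtain ⟨⟨a0, a1, a2, a3, a4⟩, d0, d1, d2, d3, d4⟩ := hP
  refine ⟨⟨?_, ?_, ?_, ?_, ?_⟩, ?_, ?_, ?_, ?_, ?_⟩ <;> simp [*]

lemma P2.z {M : M5} (hP : P2 M) : P2 (mZ * M) := by
  obtain ⟨⟨a0, a1, a2, a3, a4⟩, d0, d1, d2, d3, d4⟩ := hP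
  refine ⟨⟨?_, ?_, ?_, ?_, ?_⟩, ?_, ?_, ?_, ?_, ?_⟩ <;> simp [*]

lemma round_div {c w : ℤ} (hc : c ≠ 0) (hlt : |c| < 2 * |w|) :
    ∃ k, |w - k * c| < |w| := by
  rcases lt_or_gt_of_ne hc with hc | hc <;> rcases le_or_gt 0 w with hw | hw
  · rw [abs_of_neg hc, abs_of_nonneg hw] at hlt
    exact ⟨-1, by rw [abs_of_nonneg hw, abs_lt]; constructor <;> linarith⟩
  · rw [abs_of_neg hc, abs_of_neg hw] at hlt
    exact ⟨1, by rw [abs_of_neg hw, abs_lt]; constructor <;> linarith⟩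
  · rw [abs_of_pos hc, abs_of_nonneg hw] at hlt
    exact ⟨1, by rw [abs_of_nonneg hw, abs_lt]; constructor <;> linarith⟩
  · rw [abs_of_pos hc, abs_of_neg hw] at hlt
    exact ⟨-1, by rw [abs_of_neg hw, abs_lt]; constructor <;> linarith⟩

lemma zcore {b c w : ℤ} (hw : 0 < w) (h : b * c = 8 * w ^ 2) (hb : 2 * w ≤ b) (hc : 2 * w ≤ c)
    (h2 : b ≠ 2 * w) (h4 : c ≠ 2 * w) : |3 * b + 3 * c - 17 * w| < w := by
  have hb' : 2 * w < b := lt_of_le_of_ne hb (Ne.symm h2)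
  have hc' : 2 * w < c := lt_of_le_of_ne hc (Ne.symm h4)
  have h1 : 16 * w < 3 * (b + c) := by
    by_contra hcon
    push Not at hcon
    nlinarith [sq_nonneg (b - c), mul_le_mul hcon hcon (by linarith) (by linarith)]
  have h3 : b + c < 6 * w := by
    -- (b - 2w)(c - 2w) > 0
    have := mul_pos (sub_pos.2 hb') (sub_pos.2 hc')
    have h5 : 0 < 2 * w * (6 * w - (b + c)) := by nlinarith
    have := (mul_pos_iff_of_pos_left (show 0 < 2 * w by linarith)).1 h5
    linarith
  rw [abs_lt]
  constructor <;> linarith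

lemma zred {b c w : ℤ} (hw : w ≠ 0) (h : b * c + 8 * w ^ 2 = 0) (hb : 2 * |w| ≤ |b|)
    (hc : 2 * |w| ≤ |c|) (h2 : |b| ≠ 2 * |w|) (h4 : |c| ≠ 2 * |w|) :
    |3 * b - 3 * c - 17 * w| < |w| ∨ |3 * b - 3 * c + 17 * w| < |w| := by
  have hw' := abs_pos.2 hw
  have hbc : |b| * |c| = 8 * |w| ^ 2 := by
    rw [← abs_mul, sq_abs, show b * c = -(8 * w ^ 2) by linarith, abs_neg,
      abs_of_nonneg (by positivity)]
  have key := zcore hw' hbc hb hc h2 h4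
  have hneg : b * c < 0 := by have : 0 < w ^ 2 := by positivity
                              linarith
  rcases mul_neg_iff.1 hneg with ⟨b0, c0⟩ | ⟨b0, c0⟩ <;> rcases lt_or_gt_of_ne hw with w0 | w0
  · right; rw [abs_of_pos b0, abs_of_neg c0, abs_of_neg w0] at key
    rw [abs_of_neg w0]; convert key using 2; ring
  · left; rw [abs_of_pos b0, abs_of_neg c0, abs_of_pos w0] at key
    rw [abs_of_pos w0]; convert key using 2; ring
  · left; rw [abs_of_neg b0, abs_of_pos c0, abs_of_neg w0] at key
    rw [abs_of_neg w0, ← abs_neg]; convert key using 2; ring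
  · right; rw [abs_of_neg b0, abs_of_pos c0, abs_of_pos w0] at key
    rw [abs_of_pos w0, ← abs_neg]; convert key using 2; ring

lemma even_of_abs {b c w : ℤ} (hw : w ≠ 0) (h : b * c + 8 * w ^ 2 = 0) (h2 : |b| = 2 * |w|) :
    2 ∣ b ∧ 2 ∣ c := by
  rw [show (2 : ℤ) * |w| = |2 * w| by rw [abs_mul]; simp] at h2
  rcases abs_eq_abs.1 h2 with hb | hb
  · refine ⟨⟨w, hb⟩, ⟨-2 * w, ?_⟩⟩
    rw [hb] at h
    have : (2 * w) * (c + 4 * w) = 0 := by linarith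
    rcases mul_eq_zero.1 this with h5 | h5
    · omega
    · linarith
  · refine ⟨⟨-w, by linarith⟩, ⟨2 * w, ?_⟩⟩
    rw [hb] at h
    have : (2 * w) * (c - 4 * w) = 0 := by linarith
    rcases mul_eq_zero.1 this with h5 | h5
    · omega
    · linarith

lemma step3 (h : Good I) (n : ℕ) : ∀ M, Iso M → P2 M → (M 4 1).natAbs = n → Reach I P3 M := by
  induction n using Nat.strong_induction_on with
  | _ n ih =>
  intro M hM hP hn
  by_cases hw : M 4 1 = 0
  · exact ⟨1, h.one, by rw [Matrix.one_mul]; exact ⟨hP, hw⟩⟩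
  have go : ∀ X, I X → P2 (X * M) → |(X * M) 4 1| < |M 4 1| → Reach I P3 M := by
    intro X hX hPX hlt
    refine Reach.step h hX (ih _ ?_ _ (Iso.mul (h.iso _ hX) hM) hPX rfl)
    rw [Int.abs_eq_natAbs, Int.abs_eq_natAbs] at hlt
    omega
  obtain ⟨z01, z31⟩ := hP.ext hM 1 (by decide) (by decide)
  obtain ⟨z02, z32⟩ := hP.ext hM 2 (by decide) (by decide)
  have e11 := hM.entry 1 1
  have e12 := hM.entry 1 2
  simp [qN, z01, z31, z02, z32] at e11 e12
  have hbc : M 1 1 * M 2 1 + 8 * M 4 1 ^ 2 = 0 := by linarith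
  have hw2 : 0 < M 4 1 ^ 2 := by positivity
  have hb0 : M 1 1 ≠ 0 := by intro h0; rw [h0] at hbc; linarith
  have hc0 : M 2 1 ≠ 0 := by intro h0; rw [h0] at hbc; linarith
  by_cases c1 : |M 2 1| < 2 * |M 4 1|
  · obtain ⟨k, hk⟩ := round_div hc0 c1
    exact go _ (gTB h k) (hP.tb k) (by simpa using hk)
  by_cases c2 : |M 1 1| < 2 * |M 4 1|
  · obtain ⟨k, hk⟩ := round_div hb0 c2
    exact go _ (gTC h k) (hP.tc k) (by simpa using hk)
  push Not at c1 c2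
  have odd : ¬ (2 ∣ M 1 1 ∧ 2 ∣ M 2 1) := by
    rintro ⟨⟨x, hx⟩, ⟨y, hy⟩⟩
    rw [hx, hy] at e12
    have : 2 * (x * M 2 2 + y * M 1 2 + 8 * (M 4 1 * M 4 2)) = 1 := by linarith
    omega
  rcases zred hw hbc c2 c1 (fun h2 => odd (even_of_abs hw hbc h2))
    (fun h2 => odd (even_of_abs hw (by rw [mul_comm]; exact hbc) h2).symm) with hz | hz
  · exact go _ (gZ h) hP.z (by simpa using hz)
  · refine go _ (h.mul _ _ (gZ h) (gR h)) ?_ ?_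
    · rw [Matrix.mul_assoc]; exact hP.r.z
    · rw [Matrix.mul_assoc]; simpa using hz

lemma step4 (h : Good I) (M : M5) (hM : Iso M) (hP : P3 M) : Reach I P4 M := by
  -- the case where the second column is a multiple of `e_b`
  have main : ∀ M, Iso M → P3 M → M 2 1 = 0 → Reach I P4 M := by
    intro M hM hP hc
    obtain ⟨hP, hw⟩ := hP
    obtain ⟨z01, z31⟩ := hP.ext hM 1 (by decide) (by decide)
    obtain ⟨z02, z32⟩ := hP.ext hM 2 (by decide) (by decide)
    have e12 := hM.entry 1 2
    simp [qN, z01, z31, z02, z32, hc, hw] at e12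
    -- now make the third column a multiple of `e_c`
    have hX := gTB h (M 4 2 * M 1 1)
    have hM' := Iso.mul (h.iso _ hX) hM
    have hP' := hP.tb (M 4 2 * M 1 1)
    have k1 : (TB (M 4 2 * M 1 1) * M) 1 1 = M 1 1 := by simp [hc, hw]
    have k2 : (TB (M 4 2 * M 1 1) * M) 2 1 = 0 := by simp [hc]
    have k3 : (TB (M 4 2 * M 1 1) * M) 4 1 = 0 := by simp [hc, hw]
    have k4 : (TB (M 4 2 * M 1 1) * M) 2 2 = M 2 2 := by simp
    have k5 : (TB (M 4 2 * M 1 1) * M) 4 2 = 0 := by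
      simp only [row_TB]
      rw [mul_assoc, e12]; ring
    refine Reach.step h hX ⟨1, h.one, ?_⟩
    rw [Matrix.one_mul]
    generalize TB (M 4 2 * M 1 1) * M = N at *
    obtain ⟨z01, z31⟩ := hP'.ext hM' 1 (by decide) (by decide)
    obtain ⟨z02, z32⟩ := hP'.ext hM' 2 (by decide) (by decide)
    obtain ⟨z04, z34⟩ := hP'.ext hM' 4 (by decide) (by decide)
    have hu : M 1 1 = 1 ∧ M 2 2 = 1 ∨ M 1 1 = -1 ∧ M 2 2 = -1 := Int.mul_eq_one_iff_eq_one_or_neg_one.1 e12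
    have f22 := hM'.entry 2 2
    have f14 := hM'.entry 1 4
    have f24 := hM'.entry 2 4
    have f44 := hM'.entry 4 4
    obtain ⟨⟨a0, a1, a2, a3, a4⟩, d0, d1, d2, d3, d4⟩ := hP'
    simp [qN, z01, z31, z02, z32, z04, z34, k1, k2, k3, k4, k5] at f22 f14 f24 f44
    have n11 : N 1 1 ≠ 0 := by rcases hu with hu | hu <;> rw [k1, hu.1] <;> decide
    have n22 : N 2 2 ≠ 0 := by rcases hu with hu | hu <;> rw [k4, hu.2] <;> decide
    rw [← k1] at f14
    rw [← k4] at f22 f24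
    have g24 : N 2 4 = 0 := by simpa [n11] using f14
    have g12 : N 1 2 = 0 := by
      have : N 2 2 * N 1 2 = 0 := by linarith
      simpa [n22] using this
    have g14 : N 1 4 = 0 := by
      rw [g12] at f24
      have : N 2 2 * N 1 4 = 0 := by linarith
      simpa [n22] using this
    have g44 : N 4 4 = 1 ∨ N 4 4 = -1 := by
      rw [g14, g24] at f44
      have : N 4 4 * N 4 4 = 1 := by linarith
      exact mul_self_eq_one_iff.1 this
    intro i j
    rcases hu with hu | hu <;> rcases g44 with g44 | g44 <;> fin_cases i <;> fin_cases j <;>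
      simp [*]
  by_cases hc : M 2 1 = 0
  · exact main M hM hP hc
  have z := hP.1.ext hM 1 (by decide) (by decide)
  have e11 := hM.entry 1 1
  simp [qN, z.1, z.2, hP.2] at e11
  have hb : M 1 1 * M 2 1 = 0 := by linarith
  have hb : M 1 1 = 0 := by simpa [hc] using hb
  refine Reach.step h (gC h) (main _ (Iso.mul (h.iso _ (gC h)) hM) ⟨hP.1.c, ?_⟩ ?_)
  · simpa using hP.2
  · simpa using hb

theorem core (h : Good I) (M : M5) (hM : Iso M) : Reach I P4 M :=
  (((step1 h M hM).trans h hM (step2 h)).trans h hM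
    (fun N hN hP => step3 h _ N hN hP rfl)).trans h hM (step4 h)

end reduction

/-- Unimodular change of basis. -/
def cR : M5 :=
  !![(-1 : ℤ), -4, 2, 1, -1; 0, 4, -1, 0, 1; 1, -5, 0, 0, -1; 0, 2, 2, 1, 0; 0, -1, -1, 0, 0]

/-- Inverse of `cR`. -/
def cRi : M5 :=
  !![(0 : ℤ), 1, 1, 0, -1; -1, -2, -1, 1, 2; 1, 2, 1, -1, -3; 0, 0, 0, 1, 2; 5, 11, 5, -5, -11]

/-- Scaling of the last coordinate. -/
def cS : M5 := Matrix.diagonal ![1, 1, 1, 1, 16]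

/-- The complementary scaling. -/
def cS' : M5 := Matrix.diagonal ![16, 16, 16, 16, 1]

/-- The change of coordinates. -/
def cP : M5 := cR * cS

/-- `16` times the inverse of `cP`. -/
def cP' : M5 := cS' * cRi

lemma cP'_mul : cP' * cP = (16 : ℤ) • (1 : M5) := by decide +kernel

lemma cP_mul : cP * cP' = (16 : ℤ) • (1 : M5) := by decide +kernel

lemma cP_form : cPᵀ * matQ * cP = (16 : ℤ) • qN := by decide +kernel

lemma smul_cancel {X Y : M5} (h : (16 : ℤ) • X = (16 : ℤ) • Y) : X = Y :=
  smul_right_injective M5 (by norm_num : (16 : ℤ) ≠ 0) h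

lemma cP_left {X Y : M5} (h : cP * X = cP * Y) : X = Y := by
  have := congrArg (cP' * ·) h
  simp only [← Matrix.mul_assoc, cP'_mul, Matrix.smul_mul, Matrix.one_mul] at this
  exact smul_cancel this

lemma cP_right {X Y : M5} (h : X * cP = Y * cP) : X = Y := by
  have := congrArg (· * cP') h
  simp only [Matrix.mul_assoc, cP_mul, Matrix.mul_smul, Matrix.mul_one] at this
  exact smul_cancel this

/-- An isometry of `matQ` is integral in the new coordinates. -/
lemma exists_conj (M N : M5) (hM : Mᵀ * matQ * M = matQ) (hMN : M * N = 1) :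
    ∃ X : M5, cP * X = M * cP ∧ Iso X := by
  have hQ : matQ * M = Nᵀ * matQ := by
    have h1 : Nᵀ * Mᵀ = 1 := by rw [← Matrix.transpose_mul, hMN, Matrix.transpose_one]
    calc matQ * M = (Nᵀ * Mᵀ) * matQ * M := by rw [h1, Matrix.one_mul]
      _ = Nᵀ * (Mᵀ * matQ * M) := by simp only [Matrix.mul_assoc]
      _ = _ := by rw [hM]
  have hi : cR * cRi = 1 := by decide +kernel
  -- the conjugates by the unimodular matrix
  obtain ⟨M', hM'⟩ : ∃ M', M' = cRi * M * cR := ⟨_, rfl⟩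
  obtain ⟨N', hN'⟩ : ∃ N', N' = cRi * N * cR := ⟨_, rfl⟩
  have hMc : M * cR = cR * M' := by
    rw [hM', ← Matrix.mul_assoc, ← Matrix.mul_assoc, hi, Matrix.one_mul]
  have hNc : N * cR = cR * N' := by
    rw [hN', ← Matrix.mul_assoc, ← Matrix.mul_assoc, hi, Matrix.one_mul]
  let q' : M5 := !![(0 : ℤ), 0, 0, 16, 0; 0, 0, -16, 0, 0; 0, -16, 0, 0, 0; 16, 0, 0, 0, 0;
    0, 0, 0, 0, -1]
  have hq' : cRᵀ * matQ * cR = q' := by decide +kernel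
  have hrel : q' * M' = N'ᵀ * q' := by
    rw [← hq']
    calc cRᵀ * matQ * cR * M' = cRᵀ * (matQ * M) * cR := by
          simp only [Matrix.mul_assoc, hMc]
      _ = (N * cR)ᵀ * matQ * cR := by
          rw [hQ, Matrix.transpose_mul]; simp only [Matrix.mul_assoc]
      _ = _ := by rw [hNc, Matrix.transpose_mul]; simp only [Matrix.mul_assoc]
  have r : ∀ j, (q' * M') 4 j = (N'ᵀ * q') 4 j := fun j => by rw [hrel]
  have r0 := r 0
  have r1 := r 1
  have r2 := r 2
  have r3 := r 3
  simp [q', Matrix.mul_apply, Fin.sum_univ_five] at r0 r1 r2 r3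
  obtain ⟨X, hX⟩ : ∃ X : M5, X = !![M' 0 0, M' 0 1, M' 0 2, M' 0 3, 16 * M' 0 4;
    M' 1 0, M' 1 1, M' 1 2, M' 1 3, 16 * M' 1 4;
    M' 2 0, M' 2 1, M' 2 2, M' 2 3, 16 * M' 2 4;
    M' 3 0, M' 3 1, M' 3 2, M' 3 3, 16 * M' 3 4;
    -N' 3 4, N' 2 4, N' 1 4, -N' 0 4, M' 4 4] := ⟨_, rfl⟩
  have hS : cS * X = M' * cS := by
    rw [hX]
    ext i j
    fin_cases i <;> fin_cases j <;>
      simp [cS, Matrix.diagonal_mul, Matrix.mul_diagonal] <;> linarith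
  have hX : cP * X = M * cP := by
    unfold cP
    rw [Matrix.mul_assoc, hS, ← Matrix.mul_assoc, ← hMc, Matrix.mul_assoc]
  refine ⟨X, hX, smul_cancel ?_⟩
  calc (16 : ℤ) • (Xᵀ * qN * X) = Xᵀ * ((16 : ℤ) • qN) * X := by
        rw [Matrix.mul_smul, Matrix.smul_mul]
    _ = (cP * X)ᵀ * matQ * (cP * X) := by
        rw [← cP_form, Matrix.transpose_mul]; simp only [Matrix.mul_assoc]
    _ = cPᵀ * (Mᵀ * matQ * M) * cP := by
        rw [hX, Matrix.transpose_mul]; simp only [Matrix.mul_assoc]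
    _ = (16 : ℤ) • qN := by rw [hM, cP_form]

/-- Matrices which, up to sign, are conjugate to an element of the group `H`. -/
def InG (H : Subgroup (GL (Fin 5) ℤ)) (X : M5) : Prop :=
  Iso X ∧ ∃ u ∈ H, cP * X = (u : M5) * cP ∨ cP * (-X) = (u : M5) * cP

lemma good_InG (A B : GL (Fin 5) ℤ) (hA : (A : M5) = matA) (hB : (B : M5) = matB) :
    Good (InG (Subgroup.closure {A, B})) where
  one := ⟨by simp [Iso], 1, one_mem _, by simp⟩
  mul := by
    rintro X Y ⟨iX, u, hu, hX⟩ ⟨iY, v, hv, hY⟩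
    refine ⟨iX.mul iY, u * v, mul_mem hu hv, ?_⟩
    rw [Units.val_mul]
    rcases hX with hX | hX <;> rcases hY with hY | hY
    · left; rw [← Matrix.mul_assoc, hX, Matrix.mul_assoc, hY, Matrix.mul_assoc]
    · right; rw [← Matrix.mul_neg, ← Matrix.mul_assoc, hX, Matrix.mul_assoc, hY, Matrix.mul_assoc]
    · right; rw [← Matrix.neg_mul, ← Matrix.mul_assoc, hX, Matrix.mul_assoc, hY, Matrix.mul_assoc]
    · left
      rw [show X * Y = (-X) * (-Y) by simp, ← Matrix.mul_assoc, hX, Matrix.mul_assoc, hY,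
        Matrix.mul_assoc]
  neg := by
    rintro X ⟨iX, u, hu, hX⟩
    refine ⟨by simpa [Iso] using iX, u, hu, ?_⟩
    rw [neg_neg]
    exact hX.symm
  inv := by
    rintro X Y hXY ⟨iX, u, hu, hX⟩
    have key : ∀ X Y : M5, X * Y = 1 → cP * X = (u : M5) * cP →
        cP * Y = ((u⁻¹ : GL (Fin 5) ℤ) : M5) * cP := by
      intro X Y hXY hX
      have h1 : ((u⁻¹ : GL (Fin 5) ℤ) : M5) * (u : M5) = 1 := by
        rw [← Units.val_mul, inv_mul_cancel, Units.val_one]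
      calc cP * Y = (((u⁻¹ : GL (Fin 5) ℤ) : M5) * (u : M5)) * cP * Y := by
            rw [h1, Matrix.one_mul]
        _ = ((u⁻¹ : GL (Fin 5) ℤ) : M5) * (cP * X) * Y := by
            rw [hX]; simp only [Matrix.mul_assoc]
        _ = ((u⁻¹ : GL (Fin 5) ℤ) : M5) * cP * (X * Y) := by simp only [Matrix.mul_assoc]
        _ = _ := by rw [hXY, Matrix.mul_one]
    refine ⟨?_, u⁻¹, inv_mem hu, ?_⟩
    · unfold Iso at *
      have h1 : Yᵀ * Xᵀ = 1 := by rw [← Matrix.transpose_mul, hXY, Matrix.transpose_one]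
      calc Yᵀ * qN * Y = Yᵀ * (Xᵀ * qN * X) * Y := by rw [iX]
        _ = (Yᵀ * Xᵀ) * qN * (X * Y) := by simp only [Matrix.mul_assoc]
        _ = qN := by rw [h1, hXY, Matrix.one_mul, Matrix.mul_one]
    · rcases hX with hX | hX
      · exact Or.inl (key X Y hXY hX)
      · exact Or.inr (key (-X) (-Y) (by simpa using hXY) hX)
  iso := fun X hX => hX.1
  a := ⟨by unfold Iso; decide +kernel, A, Subgroup.subset_closure (by simp),
    Or.inl (by rw [hA]; decide +kernel)⟩
  b := ⟨by unfold Iso; decide +kernel, B, Subgroup.subset_closure (by simp),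
    Or.inl (by rw [hB]; decide +kernel)⟩

/-- The finite set of small matrices. -/
lemma finite_P4 : {X : M5 | P4 X}.Finite := by
  have h : {f : Fin 5 → Fin 5 → ℤ | ∀ i, f i ∈
      {g : Fin 5 → ℤ | ∀ j, g j ∈ (↑(Finset.Icc (-1 : ℤ) 1) : Set ℤ)}}.Finite :=
    Set.Finite.pi' fun _ => Set.Finite.pi' fun _ => Finset.finite_toSet _
  refine Set.Finite.subset h ?_
  intro X hX i j
  exact Finset.mem_coe.2 (hX i j)

/-- Elements of `GL₅(ℤ)` conjugate to a small matrix. -/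
def smallSet : Set (GL (Fin 5) ℤ) := {g | ∃ X : M5, P4 X ∧ cP * X = (g : M5) * cP}

lemma finite_small : smallSet.Finite := by
  classical
  have hsub : ∀ g : smallSet, ∃ X : M5, P4 X ∧ cP * X = ((g : GL (Fin 5) ℤ) : M5) * cP :=
    fun g => g.2
  choose f hf1 hf2 using hsub
  haveI : Finite {X : M5 | P4 X} := finite_P4
  have : Finite smallSet := by
    refine Finite.of_injective (fun g => (⟨f g, hf1 g⟩ : {X : M5 | P4 X})) ?_
    intro g g' hgg
    have h1 : f g = f g' := congrArg Subtype.val hgg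
    apply Subtype.ext
    apply Units.ext
    apply cP_right
    rw [← hf2, ← hf2, h1]
  exact this

/-- A subgroup which meets finitely many translates has finite index. -/
lemma finiteIndex_of_cover {G : Type*} [Group G] (K O : Subgroup G) (S : Set G) (hS : S.Finite)
    (hcov : ∀ g ∈ O, ∃ u ∈ K, u * g ∈ S) (hKO : K ≤ O) : (K.subgroupOf O).FiniteIndex := by
  haveI := hS.to_subtype
  have hc : ∀ g : O, ∃ u : G, u ∈ K ∧ u * (g : G)⁻¹ ∈ S := by
    intro g
    obtain ⟨u, hu, h⟩ := hcov _ (inv_mem g.2)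
    exact ⟨u, hu, h⟩
  choose u hu hs using hc
  haveI : Finite (O ⧸ K.subgroupOf O) := by
    refine Finite.of_injective
      (fun c : O ⧸ K.subgroupOf O => (⟨_, hs (Quotient.out c)⟩ : S)) ?_
    intro c c' h
    have h1 : u (Quotient.out c) * ((Quotient.out c : O) : G)⁻¹
      = u (Quotient.out c') * ((Quotient.out c' : O) : G)⁻¹ := congrArg Subtype.val h
    rw [← QuotientGroup.out_eq' c, ← QuotientGroup.out_eq' c', QuotientGroup.eq,
      Subgroup.mem_subgroupOf]
    have h2 : (((Quotient.out c : O)⁻¹ * Quotient.out c' : O) : G)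
        = (u (Quotient.out c))⁻¹ * u (Quotient.out c') := by
      have h3 := eq_inv_mul_of_mul_eq h1
      push_cast
      rw [h3]; group
    rw [h2]
    exact mul_mem (inv_mem (hu _)) (hu _)
  exact Subgroup.finiteIndex_of_finite_quotient

lemma P4.neg {X : M5} (h : P4 X) : P4 (-X) := by
  intro i j
  have := h i j
  simp only [Finset.mem_Icc, Matrix.neg_apply] at *
  omega

end HG

/-- Case 4 of Theorem 1.2: the hypergeometric group `Γ(f,g)` generated by the companion matrices `A`, `B`
of `f(x) = x^5 - 3*x^4 + 4*x^3 - 4*x^2 + 3*x - 1` and `g(x) = x^5 - x^4 + x^3 + x^2 - x + 1`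
is an arithmetic subgroup of `O_Q(ℤ)`: it preserves `Q`, it is contained in `O_Q(ℤ)`,
and it has finite index in `O_Q(ℤ)`. -/
theorem hypergeometric_group_arithmetic
    (A B : GL (Fin 5) ℤ)
    (hA : (A : Matrix (Fin 5) (Fin 5) ℤ) = matA)
    (hB : (B : Matrix (Fin 5) (Fin 5) ℤ) = matB) :
    matAᵀ * matQ * matA = matQ ∧
    matBᵀ * matQ * matB = matQ ∧
    Subgroup.closure {A, B} ≤ orthogonalSubgroup matQ ∧
    ((Subgroup.closure {A, B}).subgroupOf (orthogonalSubgroup matQ)).FiniteIndex := by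
  have h1 : matAᵀ * matQ * matA = matQ := by decide +kernel
  have h2 : matBᵀ * matQ * matB = matQ := by decide +kernel
  have h3 : Subgroup.closure {A, B} ≤ orthogonalSubgroup matQ := by
    rw [Subgroup.closure_le]
    rintro x (rfl | rfl)
    · change (x : HG.M5)ᵀ * matQ * (x : HG.M5) = matQ
      rw [hA]; exact h1
    · change (x : HG.M5)ᵀ * matQ * (x : HG.M5) = matQ
      rw [hB]; exact h2
  refine ⟨h1, h2, h3, HG.finiteIndex_of_cover _ _ HG.smallSet HG.finite_small ?_ h3⟩
  intro g hg
  have hg' : (g : HG.M5)ᵀ * matQ * (g : HG.M5) = matQ := hg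
  obtain ⟨X, hX, iX⟩ := HG.exists_conj g ((g⁻¹ : GL (Fin 5) ℤ) : HG.M5) hg'
    (by rw [← Units.val_mul, mul_inv_cancel, Units.val_one])
  obtain ⟨Y, ⟨-, u, hu, hY⟩, hs⟩ := HG.core (HG.good_InG A B hA hB) X iX
  refine ⟨u, hu, ?_⟩
  rcases hY with hY | hY
  · refine ⟨Y * X, hs, ?_⟩
    rw [← Matrix.mul_assoc, hY, Matrix.mul_assoc, hX, ← Matrix.mul_assoc, Units.val_mul]
  · refine ⟨-(Y * X), hs.neg, ?_⟩
    rw [← Matrix.neg_mul, ← Matrix.mul_assoc, hY, Matrix.mul_assoc, hX, ← Matrix.mul_assoc,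
      Units.val_mul]
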